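/- arXiv:2512.12988 — 3 statements merged into one kernel-verified Lean document; each statement's English description precedes it below -/
import Mathlib

section
/- Let σ, σ' > 0 and let G, G' be Borel probability measures on ℝ with compact support. If ∫ g_{u,σ}(x) dG(u) = ∫ g_{u,σ'}(x) dG'(u) for every x ∈ ℝ, then σ = σ' and G = G'. -/
open MeasureTheory

/-- The normal density on ℝ with mean `u` and standard deviation `σ`:
`g_{u,σ}(x) = (1/(√(2π)σ)) exp(−(x−u)²/(2σ²))`. -/
noncomputable def gaussD (u σ x : ℝ) : ℝ :=
  (1 / (Real.sqrt (2 * Real.pi) * σ)) * Real.exp (-(x - u) ^ 2 / (2 * σ ^ 2))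

open ProbabilityTheory

lemma gaussD_eq (u σ x : ℝ) (hσ : 0 < σ) :
    gaussD u σ x = gaussianPDFReal u (σ ^ 2).toNNReal x := by
  unfold gaussD gaussianPDFReal
  rw [Real.coe_toNNReal _ (sq_nonneg σ)]
  rw [Real.sqrt_mul (by positivity : (0:ℝ) ≤ 2 * Real.pi) (σ ^ 2), Real.sqrt_sq hσ.le, one_div]

lemma gaussD_cont (σ x : ℝ) : Continuous (fun u => gaussD u σ x) := by
  unfold gaussD; fun_prop

lemma gaussD_nonneg (u σ x : ℝ) (hσ : 0 < σ) : 0 ≤ gaussD u σ x := by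
  unfold gaussD; positivity

lemma gaussD_int (σ x : ℝ) (hσ : 0 < σ) (G : Measure ℝ) [IsProbabilityMeasure G] :
    Integrable (fun u => gaussD u σ x) G := by
  refine Integrable.of_bound (gaussD_cont σ x).aestronglyMeasurable
    (1 / (Real.sqrt (2 * Real.pi) * σ)) (Filter.Eventually.of_forall fun u => ?_)
  rw [Real.norm_of_nonneg (gaussD_nonneg u σ x hσ)]
  unfold gaussD
  refine mul_le_of_le_one_right (by positivity) ?_
  rw [Real.exp_le_one_iff]
  exact div_nonpos_of_nonpos_of_nonneg (by nlinarith [sq_nonneg (x - u)]) (by positivity)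

lemma conv_form (σ : ℝ) (hσ : 0 < σ) (G : Measure ℝ) [IsProbabilityMeasure G] :
    G.conv (gaussianReal 0 (σ ^ 2).toNNReal) =
      volume.withDensity (fun x => ENNReal.ofReal (∫ u, gaussD u σ x ∂G)) := by
  have hv : (σ ^ 2).toNNReal ≠ 0 := (Real.toNNReal_pos.2 (by positivity)).ne'
  ext s hs
  rw [withDensity_apply _ hs]
  rw [← lintegral_indicator_one hs,
    Measure.lintegral_conv (measurable_one.indicator hs)]
  have h1 : ∀ u : ℝ, ∫⁻ y, s.indicator 1 (u + y) ∂(gaussianReal 0 (σ ^ 2).toNNReal)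
      = ∫⁻ x in s, ENNReal.ofReal (gaussD u σ x) := by
    intro u
    have h2 := gaussianReal_map_const_add (μ := 0) (v := (σ ^ 2).toNNReal) u
    rw [← lintegral_map (f := s.indicator 1) (g := fun y => u + y)
      (measurable_one.indicator hs) (by fun_prop), h2, lintegral_indicator_one hs,
      gaussianReal_apply _ hv]
    simp only [gaussianPDF, gaussD_eq _ σ _ hσ, zero_add]
  simp_rw [h1]
  rw [lintegral_lintegral_swap]
  · refine lintegral_congr fun x => ?_
    rw [ofReal_integral_eq_lintegral_ofReal (gaussD_int σ x hσ G)
      (Filter.Eventually.of_forall fun u => gaussD_nonneg u σ x hσ)]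
  · apply Measurable.aemeasurable
    unfold gaussD Function.uncurry
    fun_prop

open Filter in
lemma not_lt_aux (σ σ' : ℝ) (hσ : 0 < σ) (hσ' : 0 < σ')
    (G G' : Measure ℝ) [IsProbabilityMeasure G] [IsProbabilityMeasure G']
    (hG : ∃ s : Set ℝ, IsCompact s ∧ G sᶜ = 0)
    (hG' : ∃ s : Set ℝ, IsCompact s ∧ G' sᶜ = 0)
    (heq : ∀ x : ℝ, (∫ u, gaussD u σ x ∂G) = ∫ u, gaussD u σ' x ∂G') :
    ¬ σ < σ' := by
  intro hlt
  obtain ⟨s, hs, hs0⟩ := hG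
  obtain ⟨s', hs', hs0'⟩ := hG'
  obtain ⟨R, hR⟩ := (hs.union hs').isBounded.exists_norm_le
  have hR1 : ∀ᵐ u ∂G, |u| ≤ R := by
    have : ∀ᵐ u ∂G, u ∈ s := hs0
    filter_upwards [this] with u hu using hR u (Or.inl hu)
  have hR2 : ∀ᵐ u ∂G', |u| ≤ R := by
    have : ∀ᵐ u ∂G', u ∈ s' := hs0'
    filter_upwards [this] with u hu using hR u (Or.inr hu)
  have key : ∀ x : ℝ, R ≤ x → gaussD (-R) σ' x ≤ gaussD R σ x := by
    intro x hx
    have a1 : gaussD (-R) σ' x ≤ ∫ u, gaussD u σ' x ∂G' := by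
      have : ∫ u, gaussD (-R) σ' x ∂G' ≤ ∫ u, gaussD u σ' x ∂G' := by
        refine integral_mono_ae (integrable_const _) (gaussD_int σ' x hσ' G') ?_
        filter_upwards [hR2] with u hu
        have := abs_le.1 hu
        unfold gaussD
        have : (x - u) ^ 2 ≤ (x - -R) ^ 2 := by nlinarith
        gcongr
      simpa using this
    have a2 : ∫ u, gaussD u σ x ∂G ≤ gaussD R σ x := by
      have : ∫ u, gaussD u σ x ∂G ≤ ∫ u, gaussD R σ x ∂G := by
        refine integral_mono_ae (gaussD_int σ x hσ G) (integrable_const _) ?_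
        filter_upwards [hR1] with u hu
        have := abs_le.1 hu
        unfold gaussD
        have : (x - R) ^ 2 ≤ (x - u) ^ 2 := by nlinarith
        gcongr
      simpa using this
    rw [heq x] at a2
    exact a1.trans a2
  -- tails
  set a := 1 / (2 * σ ^ 2) with ha
  set b := 1 / (2 * σ' ^ 2) with hb
  have hab : 0 < a - b := by
    rw [sub_pos, ha, hb]
    gcongr
  have key2 : ∀ x : ℝ, R ≤ x → (a * (x - R) ^ 2 - b * (x + R) ^ 2) ≤ σ' / σ := by
    intro x hx
    have h := key x hx
    unfold gaussD at h
    have e1 : -(x - R) ^ 2 / (2 * σ ^ 2) = -(a * (x - R) ^ 2) := by rw [ha]; ring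
    have e2 : -(x - -R) ^ 2 / (2 * σ' ^ 2) = -(b * (x + R) ^ 2) := by rw [hb]; ring
    rw [e1, e2] at h
    have hp : 0 < Real.sqrt (2 * Real.pi) := by positivity
    have h3 : Real.exp (a * (x - R) ^ 2 - b * (x + R) ^ 2) ≤ σ' / σ := by
      rw [sub_eq_add_neg, Real.exp_add]
      have h4 := mul_le_mul_of_nonneg_left h
        (by positivity : 0 ≤ Real.sqrt (2 * Real.pi) * σ' * Real.exp (a * (x - R) ^ 2))
      have h5 : Real.exp (a * (x - R) ^ 2) * Real.exp (-(a * (x - R) ^ 2)) = 1 := by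
        rw [← Real.exp_add]; simp
      calc _ = Real.sqrt (2 * Real.pi) * σ' * Real.exp (a * (x - R) ^ 2) *
            (1 / (Real.sqrt (2 * Real.pi) * σ') * Real.exp (-(b * (x + R) ^ 2))) := by
              field_simp
        _ ≤ _ := h4
        _ = σ' / σ * (Real.exp (a * (x - R) ^ 2) * Real.exp (-(a * (x - R) ^ 2))) := by
              field_simp
        _ = _ := by rw [h5, mul_one]
    linarith [Real.add_one_le_exp (a * (x - R) ^ 2 - b * (x + R) ^ 2)]
  -- choose x large
  have hx : Tendsto (fun x : ℝ => x * ((a - b) * x - 2 * R * (a + b))) atTop atTop := by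
    refine tendsto_id.atTop_mul_atTop₀ ?_
    exact tendsto_atTop_add_const_right _ _ (tendsto_id.const_mul_atTop hab)
  obtain ⟨x, h1, h2⟩ := ((hx.eventually_gt_atTop (σ' / σ - (a - b) * R ^ 2)).and
    (eventually_ge_atTop R)).exists
  have := key2 x h2
  nlinarith

/-- If two compactly supported Borel probability measures `G, G'` on ℝ
give rise to the same location mixture of normals (with scales `σ, σ'` respectively),
then `σ = σ'` and `G = G'`. -/
theorem stmt0 (σ σ' : ℝ) (hσ : 0 < σ) (hσ' : 0 < σ')
    (G G' : Measure ℝ) [IsProbabilityMeasure G] [IsProbabilityMeasure G']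
    (hG : ∃ s : Set ℝ, IsCompact s ∧ G sᶜ = 0)
    (hG' : ∃ s : Set ℝ, IsCompact s ∧ G' sᶜ = 0)
    (heq : ∀ x : ℝ, (∫ u, gaussD u σ x ∂G) = ∫ u, gaussD u σ' x ∂G') :
    σ = σ' ∧ G = G' := by
  have h : σ = σ' := le_antisymm
    (not_lt.1 (not_lt_aux σ' σ hσ' hσ G' G hG' hG fun x => (heq x).symm))
    (not_lt.1 (not_lt_aux σ σ' hσ hσ' G G' hG hG' heq))
  refine ⟨h, ?_⟩
  subst h
  have hc : G.conv (gaussianReal 0 (σ ^ 2).toNNReal) =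
      G'.conv (gaussianReal 0 (σ ^ 2).toNNReal) := by
    rw [conv_form σ hσ, conv_form σ hσ]
    simp_rw [heq]
  apply Measure.ext_of_charFun
  ext t
  have ht := congrArg (fun μ => charFun μ t) hc
  simp only [charFun_conv, charFun_gaussianReal] at ht
  exact mul_right_cancel₀ (Complex.exp_ne_zero _) ht
end

section
/- Let σ > 0, c ∈ ℝ, r > 0 and let V be a Borel probability measure on ℝ with supp(V) ⊆ [c − r, c + r]. Let f(x) = ∫ g_{u,σ}(x) dV(u). Then for every j ∈ ℕ₀, |⟨f, ψ_{j,c,σ}⟩| ≤ (1/√(2σ√π)) · (r/(√2 σ))^j / √(j!). -/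
open MeasureTheory

/-- Physicists' Hermite polynomials, via the standard three-term recurrence. -/
noncomputable def hermiteP : ℕ → ℝ → ℝ
  | 0 => fun _ => 1
  | 1 => fun x => 2 * x
  | n + 2 => fun x => 2 * x * hermiteP (n + 1) x - 2 * (n + 1) * hermiteP n x

/-- Scaled Hermite function `ψ_{j,μ,σ}`. -/
noncomputable def psiH (j : ℕ) (μ σ : ℝ) (x : ℝ) : ℝ :=
  (-1 : ℝ) ^ j * (Real.sqrt (2 ^ j * (Nat.factorial j : ℝ) * σ * Real.sqrt Real.pi))⁻¹ *
    hermiteP j ((x - μ) / σ) * Real.exp (-(x - μ) ^ 2 / (2 * σ ^ 2))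

/-- `L²(ℝ)` inner product. -/
noncomputable def ip (f g : ℝ → ℝ) : ℝ := ∫ x, f x * g x


lemma hP_cont (n : ℕ) : Continuous (hermiteP n) ∧ Continuous (hermiteP (n+1)) := by
  induction n with
  | zero => exact ⟨by simp only [hermiteP]; fun_prop, by simp only [hermiteP]; fun_prop⟩
  | succ n ih =>
    refine ⟨ih.2, ?_⟩
    have h1 := ih.1
    have h2 := ih.2
    simp only [hermiteP]
    fun_prop

lemma hP_deriv (n : ℕ) :
    (∀ x, HasDerivAt (hermiteP n) (2 * x * hermiteP n x - hermiteP (n+1) x) x) ∧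
    (∀ x, HasDerivAt (hermiteP (n+1)) (2 * (n+1) * hermiteP n x) x) := by
  induction n with
  | zero =>
    constructor
    · intro x
      have := hasDerivAt_const x (1:ℝ)
      simp only [hermiteP]
      exact this.congr_deriv (by ring)
    · intro x
      have := (hasDerivAt_id x).const_mul (2:ℝ)
      simp only [hermiteP]
      exact this.congr_deriv (by simp)
  | succ n ih =>
    have e : ∀ x, hermiteP (n+1+1) x = 2 * x * hermiteP (n + 1) x - 2 * (n + 1) * hermiteP n x :=
      fun x => by simp only [hermiteP]
    constructor
    · intro x
      convert ih.2 x using 1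
      rw [e]; ring
    · intro x
      have h := (((hasDerivAt_id x).const_mul (2:ℝ)).mul (ih.2 x)).sub
        ((ih.1 x).const_mul (2 * ((n:ℝ) + 1)))
      have e' : hermiteP (n+1+1) = fun x => 2 * x * hermiteP (n + 1) x - 2 * (n + 1) * hermiteP n x :=
        funext e
      rw [e']
      exact h.congr_deriv (by simp only [id]; push_cast; ring)

lemma hP_bound (n : ℕ) :
    (∃ C, 0 ≤ C ∧ ∀ y, |hermiteP n y| ≤ C * Real.exp (n * |y|)) ∧
    (∃ C, 0 ≤ C ∧ ∀ y, |hermiteP (n+1) y| ≤ C * Real.exp ((n+1 : ℕ) * |y|)) := by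
  have key : ∀ y : ℝ, |y| ≤ Real.exp |y| := fun y => by
    linarith [Real.add_one_le_exp |y|]
  induction n with
  | zero =>
    refine ⟨⟨1, by norm_num, fun y => by simp [hermiteP]⟩, ⟨2, by norm_num, fun y => ?_⟩⟩
    simp [hermiteP, abs_mul]
    exact key y
  | succ n ih =>
    refine ⟨ih.2, ?_⟩
    obtain ⟨⟨C, hC, h1⟩, ⟨D, hD, h2⟩⟩ := ih
    refine ⟨2 * D + 2 * (n+1) * C, by positivity, fun y => ?_⟩
    have e : hermiteP (n+1+1) y = 2 * y * hermiteP (n + 1) y - 2 * (n + 1) * hermiteP n y := by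
      simp only [hermiteP]
    rw [e]
    have a1 : |2 * y * hermiteP (n+1) y| ≤ 2 * D * Real.exp ((n+1+1 : ℕ) * |y|) := by
      rw [abs_mul, abs_mul, abs_two]
      have : Real.exp ((n+1+1 : ℕ) * |y|) = Real.exp |y| * Real.exp ((n+1:ℕ) * |y|) := by
        rw [← Real.exp_add]; congr 1; push_cast; ring
      rw [this]
      calc 2 * |y| * |hermiteP (n+1) y| ≤ 2 * Real.exp |y| * (D * Real.exp ((n+1:ℕ) * |y|)) := by
            gcongr
            · exact key y
            · exact h2 y
        _ = _ := by ring
    have a2 : |2 * ((n:ℝ)+1) * hermiteP n y| ≤ 2 * (n+1) * C * Real.exp ((n+1+1 : ℕ) * |y|) := by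
      rw [abs_mul, abs_of_nonneg (by positivity : (0:ℝ) ≤ 2 * ((n:ℝ)+1))]
      have : Real.exp (n * |y|) ≤ Real.exp ((n+1+1 : ℕ) * |y|) := by
        gcongr; omega
      calc 2 * ((n:ℝ)+1) * |hermiteP n y| ≤ 2 * ((n:ℝ)+1) * (C * Real.exp ((n+1+1 : ℕ) * |y|)) := by
            gcongr
            exact (h1 y).trans (by gcongr)
        _ = _ := by ring
    calc _ ≤ |2 * y * hermiteP (n+1) y| + |2 * ((n:ℝ)+1) * hermiteP n y| := abs_sub _ _
      _ ≤ _ := by linarith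

lemma int_quad (a b : ℝ) (ha : 0 < a) : Integrable (fun y : ℝ => Real.exp (-a * y^2 + b * y)) := by
  have h := ((integrable_exp_neg_mul_sq ha).comp_sub_right (b/(2*a))).const_mul (Real.exp (b^2/(4*a)))
  refine h.congr (Filter.Eventually.of_forall fun y => ?_)
  simp only
  rw [← Real.exp_add]
  congr 1
  field_simp
  ring

lemma int_hP (n : ℕ) (a b : ℝ) (ha : 0 < a) :
    Integrable (fun y : ℝ => hermiteP n y * Real.exp (-a * y^2 + b * y)) := by
  obtain ⟨C, hC, h⟩ := (hP_bound n).1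
  have hc := (hP_cont n).1
  refine (((int_quad a (b+n) ha).add (int_quad a (b-n) ha)).const_mul C).mono'
    (by fun_prop) (Filter.Eventually.of_forall fun y => ?_)
  rw [Real.norm_eq_abs, abs_mul, Real.abs_exp]
  have h2 : Real.exp (n * |y|) ≤ Real.exp (n*y) + Real.exp (-n*y) := by
    rcases abs_cases y with ⟨e, _⟩ | ⟨e, _⟩ <;> rw [e]
    · linarith [Real.exp_pos (-n*y)]
    · rw [mul_neg, ← neg_mul]; linarith [Real.exp_pos (n*y)]
  calc _ ≤ C * (Real.exp (n*y) + Real.exp (-n*y)) * Real.exp (-a * y^2 + b * y) := by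
        gcongr
        exact (h y).trans (by gcongr)
    _ = _ := by
      simp only [Pi.add_apply]
      rw [mul_assoc, add_mul, ← Real.exp_add, ← Real.exp_add]
      congr 3 <;> ring_nf

lemma hP_integral (n : ℕ) (t : ℝ) :
    ∫ y, hermiteP n y * Real.exp (-1 * y^2 + t * y) = t^n * (Real.sqrt Real.pi * Real.exp (t^2/4)) := by
  induction n with
  | zero =>
    have := integral_gaussian 1
    have h2 := integral_sub_right_eq_self (μ := volume) (fun y : ℝ => Real.exp (-1 * y^2)) (t/2)
    rw [this] at h2
    simp only [hermiteP, pow_zero, one_mul]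
    have e : ∀ y : ℝ, Real.exp (-1 * y^2 + t * y) = Real.exp (-1 * (y - t/2)^2) * Real.exp (t^2/4) := by
      intro y
      rw [← Real.exp_add]; congr 1; ring
    simp_rw [e]
    rw [integral_mul_const, h2]; simp
  | succ n ih =>
    have hi := int_hP n 1 t one_pos
    have hi1 := int_hP (n+1) 1 t one_pos
    have h := integral_eq_zero_of_hasDerivAt_of_integrable
      (f := fun y : ℝ => hermiteP n y * Real.exp (-1 * y^2 + t * y))
      (f' := fun y : ℝ => t * (hermiteP n y * Real.exp (-1 * y^2 + t * y)) -
        hermiteP (n+1) y * Real.exp (-1 * y^2 + t * y)) ?_ ?_ hi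
    · rw [integral_sub (hi.const_mul t) hi1, integral_const_mul, ih] at h
      rw [pow_succ]; linarith
    · intro y
      have h1 : HasDerivAt (fun y : ℝ => -1 * y^2 + t * y) (-1 * (2 * y) + t) y := by
        have := ((hasDerivAt_pow 2 y).const_mul (-1:ℝ)).add ((hasDerivAt_id y).const_mul t)
        exact this.congr_deriv (by simp)
      exact (((hP_deriv n).1 y).mul h1.exp).congr_deriv (by ring)
    · exact (hi.const_mul t).sub hi1

lemma psi_cont (j : ℕ) (c σ : ℝ) : Continuous (psiH j c σ) := by
  have h := (hP_cont j).1
  unfold psiH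
  fun_prop

lemma psi_int (j : ℕ) (c σ : ℝ) (hσ : 0 < σ) : Integrable (psiH j c σ) := by
  have h := (((int_hP j (1/2) 0 (by norm_num)).comp_div hσ.ne').comp_sub_right c).const_mul
    ((-1 : ℝ) ^ j * (Real.sqrt (2 ^ j * (Nat.factorial j : ℝ) * σ * Real.sqrt Real.pi))⁻¹)
  refine h.congr (Filter.Eventually.of_forall fun x => ?_)
  simp only [psiH]
  rw [mul_assoc _ (hermiteP j _)]
  congr 3
  field_simp
  ring

lemma coef (j : ℕ) (u c σ : ℝ) (hσ : 0 < σ) :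
    ∫ x, gaussD u σ x * psiH j c σ x =
      (1 / (Real.sqrt (2 * Real.pi) * σ)) * ((-1 : ℝ) ^ j *
      (Real.sqrt (2 ^ j * (Nat.factorial j : ℝ) * σ * Real.sqrt Real.pi))⁻¹) *
      (σ * (((u-c)/σ)^j * Real.sqrt Real.pi * Real.exp (-((u-c)/σ)^2/4))) := by
  set t := (u-c)/σ with ht
  have e : ∀ x, gaussD u σ x * psiH j c σ x =
      ((1 / (Real.sqrt (2 * Real.pi) * σ)) * ((-1 : ℝ) ^ j *
      (Real.sqrt (2 ^ j * (Nat.factorial j : ℝ) * σ * Real.sqrt Real.pi))⁻¹) * Real.exp (-t^2/2)) *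
      (fun z => (fun y => hermiteP j y * Real.exp (-1 * y^2 + t * y)) (z / σ)) (x - c) := by
    intro x
    simp only [gaussD, psiH]
    have : Real.exp (-(x - u) ^ 2 / (2 * σ ^ 2)) * Real.exp (-(x - c) ^ 2 / (2 * σ ^ 2)) =
        Real.exp (-t^2/2) * Real.exp (-1 * ((x-c)/σ)^2 + t * ((x-c)/σ)) := by
      rw [← Real.exp_add, ← Real.exp_add]
      congr 1
      rw [ht]; field_simp; ring
    linear_combination ((1 / (Real.sqrt (2 * Real.pi) * σ)) * ((-1 : ℝ) ^ j *
      (Real.sqrt (2 ^ j * (Nat.factorial j : ℝ) * σ * Real.sqrt Real.pi))⁻¹) *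
      hermiteP j ((x-c)/σ)) * this
  simp_rw [e]
  rw [integral_const_mul, integral_sub_right_eq_self (μ := volume)
    (fun z => (fun y => hermiteP j y * Real.exp (-1 * y^2 + t * y)) (z / σ)) c,
    Measure.integral_comp_div (fun y => hermiteP j y * Real.exp (-1 * y^2 + t * y)) σ, hP_integral, abs_of_pos hσ, smul_eq_mul]
  have : Real.exp (-t^2/4) = Real.exp (-t^2/2) * Real.exp (t^2/4) := by
    rw [← Real.exp_add]; congr 1; ring
  rw [this]; ring

lemma const_eq (σ r : ℝ) (hσ : 0 < σ) (j : ℕ) :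
    (1 / (Real.sqrt (2 * Real.pi) * σ)) *
      (Real.sqrt (2 ^ j * (Nat.factorial j : ℝ) * σ * Real.sqrt Real.pi))⁻¹ *
      (σ * ((r/σ)^j * Real.sqrt Real.pi)) = (Real.sqrt (2 * σ * Real.sqrt Real.pi))⁻¹ *
        ((r / (Real.sqrt 2 * σ)) ^ j / Real.sqrt (Nat.factorial j)) := by
  have hp := Real.pi_pos
  have h2 : Real.sqrt (2^j) = (Real.sqrt 2)^j := by
    rw [Real.sqrt_eq_iff_eq_sq (by positivity) (by positivity), ← pow_mul, mul_comm, pow_mul,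
      Real.sq_sqrt (by norm_num)]
  rw [Real.sqrt_mul (by positivity), Real.sqrt_mul (by positivity), Real.sqrt_mul (by positivity),
    Real.sqrt_mul (by positivity) (Real.sqrt Real.pi), Real.sqrt_mul (by positivity) σ,
    Real.sqrt_mul (by positivity) (Nat.factorial j : ℝ), h2]
  have := Real.sqrt_pos.2 hσ
  have := Real.sqrt_pos.2 hp
  have := Real.sqrt_pos.2 this
  have : 0 < Real.sqrt (Nat.factorial j) := Real.sqrt_pos.2 (by positivity)
  have : 0 < Real.sqrt 2 := by positivity
  rw [div_pow, div_pow, mul_pow]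
  field_simp

/-- Lemma 16. Bound on the Hermite coefficients of a location mixture
of normals whose mixing measure is supported in `[c − r, c + r]`. -/
theorem stmt6 (σ c r : ℝ) (hσ : 0 < σ) (hr : 0 < r)
    (V : Measure ℝ) [IsProbabilityMeasure V]
    (hsupp : V (Set.Icc (c - r) (c + r))ᶜ = 0) (j : ℕ) :
    |ip (fun x => ∫ u, gaussD u σ x ∂V) (psiH j c σ)| ≤
      (Real.sqrt (2 * σ * Real.sqrt Real.pi))⁻¹ *
        ((r / (Real.sqrt 2 * σ)) ^ j / Real.sqrt (Nat.factorial j)) := by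
  have hprod : Integrable (Function.uncurry fun (x u : ℝ) => gaussD u σ x * psiH j c σ x)
      (volume.prod V) := by
    have hp : Integrable (fun z : ℝ × ℝ => psiH j c σ z.1) (volume.prod V) :=
      (psi_int j c σ hσ).comp_fst V
    have hc := psi_cont j c σ
    refine (hp.norm.const_mul (1 / (Real.sqrt (2 * Real.pi) * σ))).mono' ?_
      (Filter.Eventually.of_forall fun z => ?_)
    · apply Continuous.aestronglyMeasurable
      unfold gaussD Function.uncurry
      fun_prop
    · simp only [Function.uncurry, norm_mul]
      gcongr
      rw [Real.norm_eq_abs, gaussD, abs_mul, Real.abs_exp,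
        abs_of_nonneg (by positivity : 0 ≤ 1 / (Real.sqrt (2 * Real.pi) * σ))]
      apply mul_le_of_le_one_right (by positivity)
      rw [Real.exp_le_one_iff, neg_div]
      have : 0 ≤ (z.1 - z.2) ^ 2 / (2 * σ ^ 2) := by positivity
      linarith
  have e : ip (fun x => ∫ u, gaussD u σ x ∂V) (psiH j c σ) =
      ∫ u, (∫ x, gaussD u σ x * psiH j c σ x) ∂V := by
    unfold ip
    simp_rw [← integral_mul_const]
    exact integral_integral_swap hprod
  rw [e]
  have hae : ∀ᵐ u ∂V, u ∈ Set.Icc (c - r) (c + r) := by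
    rw [ae_iff]; exact hsupp
  have hb := norm_integral_le_of_norm_le_const (μ := V)
    (f := fun u => ∫ x, gaussD u σ x * psiH j c σ x)
    (C := (Real.sqrt (2 * σ * Real.sqrt Real.pi))⁻¹ *
        ((r / (Real.sqrt 2 * σ)) ^ j / Real.sqrt (Nat.factorial j))) ?_
  · simpa using hb
  filter_upwards [hae] with u hu
  rw [coef j u c σ hσ, ← const_eq σ r hσ j, Real.norm_eq_abs]
  simp only [abs_mul, abs_pow, abs_neg, abs_one, one_pow, one_mul, Real.abs_exp]
  rw [abs_of_nonneg (by positivity : 0 ≤ 1 / (Real.sqrt (2 * Real.pi) * σ)), abs_of_pos hσ,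
    abs_of_nonneg (Real.sqrt_nonneg Real.pi), abs_of_nonneg (inv_nonneg.2 (Real.sqrt_nonneg _)),
    abs_div, abs_of_pos hσ]
  have hu' : |u - c| ≤ r := abs_le.2 ⟨by linarith [hu.1], by linarith [hu.2]⟩
  have h1 : Real.exp (-((u-c)/σ)^2/4) ≤ 1 := by
    rw [Real.exp_le_one_iff]
    have := sq_nonneg ((u-c)/σ)
    linarith
  have h3 : (|u - c| / σ) ^ j * Real.sqrt Real.pi * Real.exp (-((u-c)/σ)^2/4) ≤
      (r/σ)^j * Real.sqrt Real.pi := by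
    rw [← mul_one ((r/σ)^j * Real.sqrt Real.pi)]
    apply mul_le_mul _ h1 (Real.exp_pos _).le (by positivity)
    gcongr
  exact mul_le_mul_of_nonneg_left (mul_le_mul_of_nonneg_left h3 hσ.le) (by positivity)
end

section
/- Let r, σ > 0. For any ℓ ≥ 1, k ∈ [ℓ] and j ≥ ℓ, Σ_{K ∈ 𝒦_j} det(U_{K∪{k}})² ≤ (e^{r²/(4σ²)} 4^ℓ (2√2 σ/r)^j √(j!))² · det(A). -/
open MeasureTheory

/-- The `2ℓ × 2ℓ` Gram matrix `A` with centers `0` and `r`. -/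
noncomputable def matA (ℓ : ℕ) (r σ : ℝ) :
    Matrix (Fin 2 × Fin ℓ) (Fin 2 × Fin ℓ) ℝ :=
  Matrix.of fun p q =>
    ip (psiH p.2 (if p.1 = 0 then 0 else r) σ) (psiH q.2 (if q.1 = 0 then 0 else r) σ)

/-- For a tuple `b : Fin ℓ → ℕ` of row indices, the `ℓ × ℓ` matrix `U_K` with
`(i,j)`-entry `⟨ψ_{j,r,σ}, ψ_{b i,0,σ}⟩`. -/
noncomputable def UKmat (ℓ : ℕ) (σ r : ℝ) (b : Fin ℓ → ℕ) : Matrix (Fin ℓ) (Fin ℓ) ℝ :=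
  Matrix.of fun i j => ip (psiH j r σ) (psiH (b i) 0 σ)

namespace Sub

lemma iadd {f g : ℝ → ℝ} (hf : Integrable f) (hg : Integrable g) :
    Integrable fun x => f x + g x := hf.add hg

lemma herm_poly (n : ℕ) : ∃ p : Polynomial ℝ, ∀ y, hermiteP n y = p.eval y := by
  induction n using Nat.strong_induction_on with
  | _ n ih =>
    match n with
    | 0 => exact ⟨1, fun y => by simp [hermiteP]⟩
    | 1 => exact ⟨2 * Polynomial.X, fun y => by simp [hermiteP]⟩
    | n + 2 =>
      obtain ⟨p, hp⟩ := ih (n + 1) (by omega)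
      obtain ⟨q, hq⟩ := ih n (by omega)
      refine ⟨2 * Polynomial.X * p - Polynomial.C (2 * ((n : ℝ) + 1)) * q, fun y => ?_⟩
      simp [hermiteP, hp, hq]

lemma herm_rec (n : ℕ) (y : ℝ) :
    hermiteP (n + 1) y = 2 * y * hermiteP n y - 2 * n * hermiteP (n - 1) y := by
  cases n with
  | zero => simp [hermiteP]
  | succ n => simp [hermiteP]

lemma herm_deriv (n : ℕ) (y : ℝ) :
    HasDerivAt (hermiteP n) (2 * n * hermiteP (n - 1) y) y := by
  induction n using Nat.strong_induction_on with
  | _ n ih =>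
    match n with
    | 0 => simpa [hermiteP] using hasDerivAt_const y (1 : ℝ)
    | 1 => simpa [hermiteP] using (hasDerivAt_id y).const_mul (2 : ℝ)
    | n + 2 =>
      have h1 := ih (n + 1) (by omega)
      have h0 := ih n (by omega)
      have h := (((hasDerivAt_id y).const_mul (2 : ℝ)).mul h1).sub
        (h0.const_mul (2 * ((n : ℝ) + 1)))
      have e : hermiteP (n + 2) = fun x => 2 * x * hermiteP (n + 1) x - 2 * (n + 1) * hermiteP n x := rfl
      rw [e]
      refine h.congr_deriv ?_
      have := herm_rec n y
      simp only [id, Nat.add_sub_cancel, show n + 2 - 1 = n + 1 by omega]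
      push_cast
      rw [this]
      ring

lemma int_pow (n : ℕ) : Integrable fun y : ℝ => y ^ n * Real.exp (-y ^ 2) := by
  have := integrable_rpow_mul_exp_neg_mul_sq (b := 1) one_pos (s := (n : ℝ))
    (by have : (0 : ℝ) ≤ n := n.cast_nonneg
        linarith)
  simpa using this

lemma int_poly0 (p : Polynomial ℝ) : Integrable fun y : ℝ => p.eval y * Real.exp (-y ^ 2) := by
  induction p using Polynomial.induction_on' with
  | add p q hp hq =>
    simpa [add_mul] using iadd hp hq
  | monomial n a =>
    simpa [mul_assoc] using (int_pow n).const_mul a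

lemma int_poly (p : Polynomial ℝ) (c : ℝ) :
    Integrable fun y : ℝ => p.eval y * Real.exp (-(y - c) ^ 2) := by
  have := (int_poly0 (p.comp (Polynomial.X + Polynomial.C c))).comp_sub_right c
  simpa using this

lemma int_poly2 (p : Polynomial ℝ) (μ ν : ℝ) :
    Integrable fun y : ℝ => p.eval y * Real.exp (-(y - μ) ^ 2 / 2) * Real.exp (-(y - ν) ^ 2 / 2) := by
  have := (int_poly p ((μ + ν) / 2)).const_mul (Real.exp (-(μ - ν) ^ 2 / 4))
  refine this.congr (Filter.Eventually.of_forall fun y => ?_)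
  simp only
  rw [mul_left_comm, ← Real.exp_add, mul_assoc, ← Real.exp_add]
  congr 2
  ring

noncomputable def nc (j : ℕ) : ℝ :=
  (-1 : ℝ) ^ j * (Real.sqrt (2 ^ j * (Nat.factorial j : ℝ) * Real.sqrt Real.pi))⁻¹

noncomputable def phi (j : ℕ) (y : ℝ) : ℝ := nc j * hermiteP j y * Real.exp (-y ^ 2 / 2)

lemma psi_phi (j : ℕ) (μ σ x : ℝ) (hσ : 0 < σ) :
    psiH j μ σ x = (Real.sqrt σ)⁻¹ * phi j (x / σ - μ / σ) := by
  unfold psiH phi nc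
  have : 2 ^ j * (Nat.factorial j : ℝ) * σ * Real.sqrt Real.pi =
    σ * (2 ^ j * (Nat.factorial j : ℝ) * Real.sqrt Real.pi) := by ring
  rw [this, Real.sqrt_mul hσ.le, mul_inv, ← sub_div]
  have : -(x - μ) ^ 2 / (2 * σ ^ 2) = -((x - μ) / σ) ^ 2 / 2 := by
    field_simp
  rw [this]
  ring

lemma ip_psi (j a : ℕ) (μ ν σ : ℝ) (hσ : 0 < σ) :
    ip (psiH j μ σ) (psiH a ν σ) = ∫ y, phi j (y - μ / σ) * phi a (y - ν / σ) := by
  unfold ip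
  have h := MeasureTheory.Measure.integral_comp_div
    (fun y => phi j (y - μ / σ) * phi a (y - ν / σ)) σ
  have e : ∀ x, psiH j μ σ x * psiH a ν σ x =
      σ⁻¹ * (phi j (x / σ - μ / σ) * phi a (x / σ - ν / σ)) := by
    intro x
    rw [psi_phi _ _ _ _ hσ, psi_phi _ _ _ _ hσ]
    have : (Real.sqrt σ)⁻¹ * (Real.sqrt σ)⁻¹ = σ⁻¹ := by
      rw [← mul_inv, Real.mul_self_sqrt hσ.le]
    rw [← this]; ring
  simp_rw [e]
  rw [integral_const_mul, h, abs_of_pos hσ, smul_eq_mul, inv_mul_cancel_left₀ hσ.ne']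

lemma phi_int (j a : ℕ) (μ ν : ℝ) :
    Integrable fun y => phi j (y - μ) * phi a (y - ν) := by
  obtain ⟨p, hp⟩ := herm_poly j
  obtain ⟨q, hq⟩ := herm_poly a
  have := (int_poly2 ((p.comp (Polynomial.X - Polynomial.C μ)) *
    (q.comp (Polynomial.X - Polynomial.C ν))) μ ν).const_mul (nc j * nc a)
  refine this.congr (Filter.Eventually.of_forall fun y => ?_)
  simp [phi, hp, hq]
  ring

noncomputable def E (d : ℝ) (j a : ℕ) : ℝ := ∫ y, phi j (y - d) * phi a y

lemma nc_rec (j : ℕ) : Real.sqrt (j + 1) * Real.sqrt 2 * nc (j + 1) = - nc j := by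
  unfold nc
  have : (2 : ℝ) ^ (j + 1) * ((j + 1).factorial : ℝ) * Real.sqrt Real.pi
      = ((j : ℝ) + 1) * (2 * (2 ^ j * (j.factorial : ℝ) * Real.sqrt Real.pi)) := by
    rw [Nat.factorial_succ]; push_cast; ring
  rw [this, Real.sqrt_mul (by positivity), Real.sqrt_mul (by positivity), pow_succ]
  have h1 : Real.sqrt ((j : ℝ) + 1) ≠ 0 := by positivity
  have h2 : Real.sqrt (2 : ℝ) ≠ 0 := by positivity
  field_simp

lemma phi_rec (j : ℕ) (y : ℝ) :
    Real.sqrt (j + 1) * phi (j + 1) y = - (Real.sqrt 2 * y * phi j y) - Real.sqrt j * phi (j - 1) y := by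
  have h2 : Real.sqrt (2 : ℝ) ≠ 0 := by positivity
  have s2 : Real.sqrt (2 : ℝ) * Real.sqrt 2 = 2 := Real.mul_self_sqrt (by norm_num)
  have h := nc_rec j
  have h1 : Real.sqrt (j + 1) * nc (j + 1) * 2 = - Real.sqrt 2 * nc j := by
    linear_combination Real.sqrt 2 * h - Real.sqrt (j + 1) * nc (j + 1) * s2
  have h' : Real.sqrt 2 * j * nc j = - Real.sqrt j * nc (j - 1) := by
    cases j with
    | zero => simp
    | succ j =>
      have h := nc_rec j
      have : Real.sqrt ((j : ℝ) + 1) * Real.sqrt (j + 1) = j + 1 := Real.mul_self_sqrt (by positivity)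
      simp only [Nat.add_sub_cancel]
      push_cast
      linear_combination Real.sqrt (j + 1) * h - Real.sqrt 2 * nc (j + 1) * this
  unfold phi
  rw [herm_rec]
  linear_combination (Real.exp (-y ^ 2 / 2) * (y * hermiteP j y - j * hermiteP (j - 1) y)) * h1
    + Real.exp (-y ^ 2 / 2) * hermiteP (j - 1) y * h'

lemma E_rec (d : ℝ) (j a : ℕ) :
    Real.sqrt (j + 1) * E d (j + 1) a = Real.sqrt (a + 1) * E d j (a + 1) +
      Real.sqrt a * E d j (a - 1) + Real.sqrt 2 * d * E d j a - Real.sqrt j * E d (j - 1) a := by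
  have I : ∀ j a, Integrable fun y => phi j (y - d) * phi a y := fun j a => by
    simpa using phi_int j a d 0
  unfold E
  simp_rw [← integral_const_mul]
  rw [← integral_add ((I _ _).const_mul _) ((I _ _).const_mul _),
    ← integral_add (iadd ((I _ _).const_mul _) ((I _ _).const_mul _)) ((I _ _).const_mul _),
    ← integral_sub (iadd (iadd ((I _ _).const_mul _) ((I _ _).const_mul _)) ((I _ _).const_mul _))
      ((I _ _).const_mul _)]
  congr 1
  ext y
  have h1 := phi_rec j (y - d)
  have h2 := phi_rec a y
  linear_combination phi a y * h1 - phi j (y - d) * h2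

lemma exp_der (d y : ℝ) : HasDerivAt (fun y => Real.exp (-(y - d) ^ 2 / 2))
    (-(y - d) * Real.exp (-(y - d) ^ 2 / 2)) y := by
  have h : HasDerivAt (fun y => -(y - d) ^ 2 / 2) (-(y - d)) y := by
    have := ((((hasDerivAt_id y).sub_const d).pow 2).neg).div_const 2
    refine this.congr_deriv ?_
    simp
    ring
  convert h.exp using 1
  ring

noncomputable def J (d : ℝ) (a b : ℕ) : ℝ :=
  ∫ y, hermiteP a y * hermiteP b y * Real.exp (-(y - d) ^ 2 / 2) * Real.exp (-(y - 0) ^ 2 / 2)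

lemma J_int (d : ℝ) (a b : ℕ) : Integrable fun y =>
    hermiteP a y * hermiteP b y * Real.exp (-(y - d) ^ 2 / 2) * Real.exp (-(y - 0) ^ 2 / 2) := by
  obtain ⟨p, hp⟩ := herm_poly a
  obtain ⟨q, hq⟩ := herm_poly b
  have := int_poly2 (p * q) d 0
  simpa [hp, hq] using this

lemma J_rec (d : ℝ) (a b : ℕ) : J d (a + 1) b = d * J d a b + 2 * b * J d a (b - 1) := by
  have h := integral_eq_zero_of_hasDerivAt_of_integrable
    (f := fun y => hermiteP a y * hermiteP b y * Real.exp (-(y - d) ^ 2 / 2) *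
      Real.exp (-(y - 0) ^ 2 / 2))
    (f' := fun y => d * (hermiteP a y * hermiteP b y * Real.exp (-(y - d) ^ 2 / 2) *
        Real.exp (-(y - 0) ^ 2 / 2)) +
      2 * b * (hermiteP a y * hermiteP (b - 1) y * Real.exp (-(y - d) ^ 2 / 2) *
        Real.exp (-(y - 0) ^ 2 / 2)) -
      (hermiteP (a + 1) y * hermiteP b y * Real.exp (-(y - d) ^ 2 / 2) *
        Real.exp (-(y - 0) ^ 2 / 2))) ?_ ?_ (J_int d a b)
  · rw [integral_sub (iadd ((J_int d _ _).const_mul _) ((J_int d _ _).const_mul _)) (J_int d _ _),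
      integral_add ((J_int d _ _).const_mul _) ((J_int d _ _).const_mul _),
      integral_const_mul, integral_const_mul] at h
    unfold J
    linarith
  · intro y
    have := ((((herm_deriv a y).mul (herm_deriv b y)).mul (exp_der d y)).mul (exp_der 0 y))
    refine this.congr_deriv ?_
    rw [herm_rec]
    simp only [Pi.mul_apply]
    ring
  · exact (((J_int d _ _).const_mul _).add ((J_int d _ _).const_mul _)).sub (J_int d _ _)

lemma J_comm (d : ℝ) (a b : ℕ) : J d a b = J d b a := by
  unfold J
  simp_rw [mul_comm (hermiteP a _)]

lemma E_zero (d : ℝ) (a : ℕ) : E d 0 a = nc 0 * nc a * d ^ a * J d 0 0 := by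
  have h : ∀ a, J d a 0 = d ^ a * J d 0 0 := by
    intro a
    induction a with
    | zero => simp
    | succ a ih => rw [J_rec, ih]; simp; ring
  have : E d 0 a = nc 0 * nc a * J d a 0 := by
    unfold E J
    rw [← integral_const_mul]
    congr 1
    ext y
    simp [phi, hermiteP]
    ring
  rw [this, h]; ring

lemma J00 (a b : ℕ) : J 0 a b = if a = b then 2 ^ a * (a.factorial : ℝ) * Real.sqrt Real.pi else 0 := by
  induction a generalizing b with
  | zero =>
    cases b with
    | zero =>
      have := integral_gaussian 1
      simp only [J, hermiteP]
      simp only [if_true, pow_zero, Nat.factorial_zero, Nat.cast_one, one_mul, div_one] at this ⊢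
      rw [← this]
      congr 1
      ext y
      rw [← Real.exp_add]
      congr 1
      ring
    | succ b => rw [J_comm, J_rec]; simp
  | succ a ih =>
    rw [J_rec]
    cases b with
    | zero => simp
    | succ b =>
      rw [zero_mul, zero_add, Nat.add_sub_cancel, ih]
      by_cases h : a = b
      · subst h
        simp [Nat.factorial_succ]; ring
      · simp [h]

lemma E_orth (a b : ℕ) : E 0 a b = if a = b then 1 else 0 := by
  have : E 0 a b = nc a * nc b * J 0 a b := by
    unfold E J
    rw [← integral_const_mul]
    congr 1
    ext y
    simp [phi]
    ring
  rw [this, J00]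
  by_cases h : a = b
  · subst h
    have hp : 0 < 2 ^ a * (a.factorial : ℝ) * Real.sqrt Real.pi := by positivity
    have := Real.mul_self_sqrt hp.le
    have h1 : ((-1 : ℝ) ^ a) * (-1) ^ a = 1 := by rw [← mul_pow]; simp
    simp only [if_true, nc]
    have h0 : Real.sqrt (2 ^ a * (a.factorial : ℝ) * Real.sqrt Real.pi) ≠ 0 := by positivity
    set S := Real.sqrt (2 ^ a * (a.factorial : ℝ) * Real.sqrt Real.pi)
    rw [← this]
    field_simp
    linarith
  · simp [h]

noncomputable def w (s : ℝ) (a : ℕ) : ℝ := s ^ a / Real.sqrt a.factorial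

lemma w_succ (s : ℝ) (a : ℕ) : Real.sqrt (a + 1) * w s (a + 1) = s * w s a := by
  unfold w
  have : ((a + 1).factorial : ℝ) = (a + 1) * a.factorial := by
    rw [Nat.factorial_succ]; push_cast; ring
  rw [this, Real.sqrt_mul (by positivity)]
  have h1 : Real.sqrt ((a : ℝ) + 1) ≠ 0 := by positivity
  field_simp
  ring

lemma w_pred (s : ℝ) (hs : s ≠ 0) (a : ℕ) : Real.sqrt a * w s (a - 1) = a / s * w s a := by
  cases a with
  | zero => simp
  | succ a =>
    have := w_succ s a
    have h3 : Real.sqrt ((a : ℝ) + 1) * Real.sqrt (a + 1) = a + 1 := Real.mul_self_sqrt (by positivity)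
    simp only [Nat.add_sub_cancel]
    push_cast
    field_simp
    linear_combination (- Real.sqrt (a + 1)) * this + w s (a + 1) * h3

lemma E_form (d : ℝ) (hd : d ≠ 0) (j : ℕ) : ∃ p : Polynomial ℝ, p.natDegree ≤ j ∧
    ∀ a : ℕ, E d j a = w (-d / Real.sqrt 2) a * p.eval (a : ℝ) := by
  have h2 : Real.sqrt (2 : ℝ) ≠ 0 := by positivity
  have hs : -d / Real.sqrt 2 ≠ 0 := div_ne_zero (neg_ne_zero.2 hd) h2
  induction j using Nat.strong_induction_on with
  | _ n ih =>
    cases n with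
    | zero =>
      refine ⟨Polynomial.C (nc 0 * (Real.sqrt (Real.sqrt Real.pi))⁻¹ * J d 0 0), by rw [Polynomial.natDegree_C], fun a => ?_⟩
      rw [E_zero, Polynomial.eval_C]
      unfold w
      have : nc a * d ^ a = (-d / Real.sqrt 2) ^ a / Real.sqrt a.factorial * (Real.sqrt (Real.sqrt Real.pi))⁻¹ := by
        unfold nc
        rw [Real.sqrt_mul (by positivity), Real.sqrt_mul (by positivity), (by rw [show (2:ℝ)^a = (Real.sqrt 2 ^ a)^2 by rw [← pow_mul, mul_comm, pow_mul, Real.sq_sqrt (by norm_num)]]; exact Real.sqrt_sq (by positivity) : Real.sqrt ((2:ℝ) ^ a) = Real.sqrt 2 ^ a), div_pow, neg_pow d]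
        field_simp
      linear_combination (nc 0 * J d 0 0) * this
    | succ j =>
      obtain ⟨p, hp, hpe⟩ := ih j (by omega)
      obtain ⟨q, hq, hqe⟩ := ih (j - 1) (by omega)
      set s := -d / Real.sqrt 2 with hsd
      have hj : Real.sqrt ((j : ℝ) + 1) ≠ 0 := by positivity
      refine ⟨Polynomial.C (Real.sqrt (j + 1))⁻¹ * (Polynomial.C s * p.comp (Polynomial.X + Polynomial.C 1)
        + Polynomial.C s⁻¹ * (Polynomial.X * p.comp (Polynomial.X - Polynomial.C 1))
        + Polynomial.C (Real.sqrt 2 * d) * p - Polynomial.C (Real.sqrt j) * q), ?_, fun a => ?_⟩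
      · have e1 : (p.comp (Polynomial.X + Polynomial.C 1)).natDegree ≤ j := by
          refine Polynomial.natDegree_comp_le.trans ?_
          rw [Polynomial.natDegree_X_add_C, mul_one]; exact hp
        have e2 : (p.comp (Polynomial.X - Polynomial.C 1)).natDegree ≤ j := by
          refine Polynomial.natDegree_comp_le.trans ?_
          rw [Polynomial.natDegree_X_sub_C, mul_one]; exact hp
        refine (Polynomial.natDegree_C_mul_le _ _).trans ?_
        refine (Polynomial.natDegree_sub_le_of_le (m := j + 1) (n := j + 1) (Polynomial.natDegree_add_le_of_degree_le
          (Polynomial.natDegree_add_le_of_degree_le ?_ ?_) ?_) ?_).trans (max_self _).le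
        · exact (Polynomial.natDegree_C_mul_le _ _).trans (by omega)
        · refine (Polynomial.natDegree_C_mul_le _ _).trans (Polynomial.natDegree_mul_le.trans ?_)
          rw [Polynomial.natDegree_X]; omega
        · exact (Polynomial.natDegree_C_mul_le _ _).trans (by omega)
        · exact (Polynomial.natDegree_C_mul_le _ _).trans (by omega)
      · have hr := E_rec d j a
        rw [hpe, hpe, hpe, hqe] at hr
        have w1 := w_succ s a
        have w2 := w_pred s hs a
        have h3 : Real.sqrt a * (w s (a - 1) * p.eval ((a - 1 : ℕ) : ℝ)) =
            a / s * w s a * p.eval ((a : ℝ) - 1) := by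
          rw [← mul_assoc, w2]
          cases a with
          | zero => simp
          | succ a => simp
        rw [h3] at hr
        simp only [Polynomial.eval_mul, Polynomial.eval_add, Polynomial.eval_sub, Polynomial.eval_C,
          Polynomial.eval_comp, Polynomial.eval_X]
        push_cast at hr
        rw [← mul_right_inj' hj, hr]
        field_simp
        linear_combination (s * p.eval ((a : ℝ) + 1)) * w1


lemma andreief {ι : Type*} [Fintype ι] [DecidableEq ι] {n : ℕ} (M : Matrix ι (Fin n) ℝ) :
    (n.factorial : ℝ) * (M.transpose * M).det = ∑ f : Fin n → ι, (M.submatrix f id).det ^ 2 := by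
  have h1 : (M.transpose * M).det = ∑ f : Fin n → ι, (∏ i, M (f i) i) * (M.submatrix f id).det := by
    have := (Matrix.detRowAlternating (n := Fin n) (R := ℝ)).toMultilinearMap.map_sum
      (fun (i : Fin n) (a : ι) => M a i • (M a : Fin n → ℝ))
    have e : (M.transpose * M) = fun i => ∑ a, M a i • (M a : Fin n → ℝ) := by
      ext i j
      simp [Matrix.mul_apply]
    rw [e]
    refine this.trans (Finset.sum_congr rfl fun f _ => ?_)
    exact (MultilinearMap.map_smul_univ _ (fun i => M (f i) i) (fun i => M (f i)))
  have h2 : ∀ f : Fin n → ι, (M.submatrix f id).det ^ 2 =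
      ∑ π : Equiv.Perm (Fin n), (∏ i, M (f (π i)) i) * (M.submatrix (f ∘ π) id).det := by
    intro f
    have hp : ∀ π : Equiv.Perm (Fin n), (M.submatrix (f ∘ π) id).det =
        ((Equiv.Perm.sign π : ℤ) : ℝ) * (M.submatrix f id).det := fun π =>
      Matrix.det_permute π (M.submatrix f id)
    simp_rw [hp]
    rw [pow_two]
    nth_rewrite 1 [Matrix.det_apply' (M.submatrix f id)]
    rw [Finset.sum_mul]
    refine Finset.sum_congr rfl fun π _ => ?_
    simp only [Matrix.submatrix_apply, id]
    ring
  simp_rw [h2]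
  rw [Finset.sum_comm]
  have h3 : ∀ π : Equiv.Perm (Fin n),
      ∑ f : Fin n → ι, (∏ i, M (f (π i)) i) * (M.submatrix (f ∘ π) id).det =
      (M.transpose * M).det := by
    intro π
    rw [h1]
    exact Fintype.sum_equiv (Equiv.arrowCongr π.symm (Equiv.refl ι)) _ _ (fun f => by
      simp [Equiv.arrowCongr, Function.comp_def])
  simp_rw [h3]
  simp [Fintype.card_perm]

/-- the mixed matrix -/
noncomputable def B {ι : Type*} (d : ℝ) (n : ℕ) (b : ι → ℕ) : Matrix ι (Fin n) ℝ :=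
  Matrix.of fun i j => E d j (b i)

lemma E_refl (d : ℝ) (i j : ℕ) : ∫ y, phi i (y - d) * phi j (y - d) = E 0 i j := by
  have := integral_sub_right_eq_self (μ := volume) (fun y => phi i y * phi j y) d
  rw [this]; simp [E]

lemma bessel {ι : Type*} [Fintype ι] [DecidableEq ι] (d : ℝ) (n : ℕ) (b : ι → ℕ)
    (hb : Function.Injective b) :
    ((1 : Matrix (Fin n) (Fin n) ℝ) - (B d n b).transpose * B d n b).PosSemidef := by
  classical
  refine Matrix.PosSemidef.of_dotProduct_mulVec_nonneg ?_ ?_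
  · ext i j
    simp [Matrix.mul_apply, Matrix.one_apply, eq_comm, mul_comm]
  · intro x
    set c : ι → ℝ := fun a => ∑ j, x j * E d j (b a) with hc
    have I1 : ∀ i j : ℕ, Integrable fun y => phi i (y - d) * phi j (y - d) := fun i j => phi_int i j d d
    have I2 : ∀ i j : ℕ, Integrable fun y => phi i (y - d) * phi j y := fun i j => by
      simpa using phi_int i j d 0
    have I3 : ∀ i j : ℕ, Integrable fun y => phi i y * phi j y := fun i j => by
      simpa using phi_int i j 0 0
    have hpos : 0 ≤ ∫ y, ((∑ j : Fin n, x j * phi j (y - d)) - ∑ a, c a * phi (b a) y) ^ 2 :=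
      integral_nonneg fun y => sq_nonneg _
    have hexp : ∀ y, ((∑ j : Fin n, x j * phi j (y - d)) - ∑ a, c a * phi (b a) y) ^ 2 =
        (∑ i : Fin n, ∑ j : Fin n, x i * x j * (phi i (y - d) * phi j (y - d))) -
        (∑ j : Fin n, ∑ a, 2 * x j * c a * (phi j (y - d) * phi (b a) y)) +
        (∑ a, ∑ a', c a * c a' * (phi (b a) y * phi (b a') y)) := by
      intro y
      rw [sub_sq, pow_two, pow_two, Finset.sum_mul_sum, Finset.sum_mul_sum, mul_assoc, Finset.sum_mul_sum,
        Finset.mul_sum]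
      congr 1
      · congr 1
        · exact Finset.sum_congr rfl fun i _ => Finset.sum_congr rfl fun j _ => by ring
        · refine Finset.sum_congr rfl fun i _ => ?_
          rw [Finset.mul_sum]
          exact Finset.sum_congr rfl fun j _ => by ring
      · exact Finset.sum_congr rfl fun i _ => Finset.sum_congr rfl fun j _ => by ring
    simp_rw [hexp] at hpos
    have J1 : Integrable fun y => (∑ i : Fin n, ∑ j : Fin n, x i * x j * (phi i (y - d) * phi j (y - d))) :=
      integrable_finsetSum _ fun i _ => integrable_finsetSum _ fun j _ => (I1 _ _).const_mul _
    have J2 : Integrable fun y => (∑ j : Fin n, ∑ a, 2 * x j * c a * (phi j (y - d) * phi (b a) y)) :=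
      integrable_finsetSum _ fun i _ => integrable_finsetSum _ fun j _ => (I2 _ _).const_mul _
    have J3 : Integrable fun y => (∑ a, ∑ a', c a * c a' * (phi (b a) y * phi (b a') y)) :=
      integrable_finsetSum _ fun i _ => integrable_finsetSum _ fun j _ => (I3 _ _).const_mul _
    rw [integral_add (by exact J1.sub J2) J3, integral_sub J1 J2,
      integral_finsetSum _ (fun i _ => integrable_finsetSum _ fun j _ => (I1 _ _).const_mul _),
      integral_finsetSum _ (fun i _ => integrable_finsetSum _ fun j _ => (I2 _ _).const_mul _),
      integral_finsetSum _ (fun i _ => integrable_finsetSum _ fun j _ => (I3 _ _).const_mul _)] at hpos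
    simp_rw [integral_finsetSum _ (fun j _ => (I1 _ _).const_mul _),
      integral_finsetSum _ (fun j _ => (I2 _ _).const_mul _),
      integral_finsetSum _ (fun j _ => (I3 _ _).const_mul _), integral_const_mul, E_refl] at hpos
    have e3 : ∀ i j, ∫ y, phi i y * phi j y = E 0 i j := fun i j => by simp [E]
    have e2 : ∀ i j, ∫ y, phi i (y - d) * phi j y = E d i j := fun i j => rfl
    simp_rw [e3, e2, E_orth, hb.eq_iff, Fin.val_inj] at hpos
    have s1 : ∑ j : Fin n, ∑ a, 2 * x j * c a * E d j (b a) = 2 * ∑ a, c a * c a := by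
      rw [Finset.sum_comm, Finset.mul_sum]
      refine Finset.sum_congr rfl fun a _ => ?_
      conv_rhs => rw [hc]
      simp only
      rw [Finset.mul_sum, Finset.mul_sum]
      refine Finset.sum_congr rfl fun j _ => ?_
      simp only [hc]
      ring
    rw [s1] at hpos
    have s2 : star x ⬝ᵥ ((1 : Matrix (Fin n) (Fin n) ℝ) - (B d n b).transpose * B d n b).mulVec x
        = ∑ j, x j * x j - ∑ a, c a * c a := by
      have hBx : (B d n b).mulVec x = c := by
        ext a; simp [Matrix.mulVec, dotProduct, B, hc, mul_comm]
      rw [Matrix.sub_mulVec, Matrix.one_mulVec, dotProduct_sub, ← Matrix.mulVec_mulVec, hBx,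
        Matrix.dotProduct_mulVec, Matrix.vecMul_transpose]
      simp [hBx, dotProduct]
    rw [s2]
    simp at hpos
    linarith

lemma detA (m : ℕ) (r σ : ℝ) (hσ : 0 < σ) : (matA m r σ).det =
    (1 - (B (r / σ) m (Fin.val : Fin m → ℕ)).transpose * B (r / σ) m (Fin.val : Fin m → ℕ)).det := by
  rw [← Matrix.det_fromBlocks_one₁₁]
  let e : Fin m ⊕ Fin m ≃ Fin 2 × Fin m :=
    { toFun := Sum.elim (fun i => (0, i)) (fun i => (1, i))
      invFun := fun p => if p.1 = 0 then Sum.inl p.2 else Sum.inr p.2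
      left_inv := by rintro (i | i) <;> simp
      right_inv := by
        rintro ⟨i, j⟩
        fin_cases i <;> simp }
  rw [← Matrix.det_submatrix_equiv_self e]
  congr 1
  ext p q
  have e3 : ∀ i j, ∫ y, phi i y * phi j y = E 0 i j := fun i j => by simp [E]
  rcases p with p | p <;> rcases q with q | q
  · simp [e, matA, ip_psi _ _ _ _ _ hσ, e3, E_orth, Matrix.one_apply, Fin.val_inj]
  · simp [e, matA, ip_psi _ _ _ _ _ hσ, B, E, mul_comm]
  · simp [e, matA, ip_psi _ _ _ _ _ hσ, B, E]
  · simp [e, matA, ip_psi _ _ _ _ _ hσ, E_refl, E_orth, Matrix.one_apply, Fin.val_inj]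

lemma exists_sqrt {n : ℕ} {Q : Matrix (Fin n) (Fin n) ℝ} (h : Q.PosSemidef) :
    ∃ R : Matrix (Fin n) (Fin n) ℝ, Q = R.transpose * R := by
  open scoped MatrixOrder in
  obtain ⟨R, hR⟩ := CStarAlgebra.nonneg_iff_eq_star_mul_self.1 h.nonneg
  exact ⟨R, by simpa [Matrix.star_eq_conjTranspose] using hR⟩

lemma cb (m : ℕ) (r σ : ℝ) (hσ : 0 < σ) (S : Finset ℕ) (hS : ∀ a ∈ S, m ≤ a) :
    ∑ f : Fin m → S, (B (r / σ) m (fun i => (f i : ℕ))).det ^ 2 ≤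
      (m.factorial : ℝ) * (matA m r σ).det := by
  set d := r / σ
  let b : Fin m ⊕ S → ℕ := Sum.elim Fin.val Subtype.val
  have hb : Function.Injective b := by
    rintro (x | x) (y | y) h
    · exact congrArg _ (Fin.ext h)
    · have := hS _ y.2
      have h : x.1 = y.1 := h
      omega
    · have := hS _ x.2
      have h : x.1 = y.1 := h
      omega
    · exact congrArg _ (Subtype.ext h)
  obtain ⟨R, hR⟩ := exists_sqrt (bessel d m b hb)
  let V : Matrix S (Fin m) ℝ := B d m (Subtype.val : S → ℕ)
  let M : Matrix (S ⊕ Fin m) (Fin m) ℝ := Matrix.fromRows V R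
  have hM : (matA m r σ).det = (M.transpose * M).det := by
    rw [detA m r σ hσ]
    congr 1
    have : (B d m b).transpose * B d m b = (B d m (Fin.val : Fin m → ℕ)).transpose *
        B d m (Fin.val : Fin m → ℕ) + V.transpose * V := by
      ext i j
      simp [Matrix.mul_apply, B, b, V]
    rw [this] at hR
    have h2 : M.transpose * M = V.transpose * V + R.transpose * R := by
      ext i j
      simp [Matrix.mul_apply, M]
    rw [h2, ← hR]
    abel
  rw [hM, andreief]
  have hinj : Function.Injective (fun (f : Fin m → S) => (fun i => (Sum.inl (f i) : S ⊕ Fin m))) := by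
    intro f g h
    ext i
    have := congrFun h i
    simpa using congrArg (Sum.elim (fun x : S => (x : ℕ)) (fun _ => 0)) this
  rw [← Finset.sum_map Finset.univ ⟨_, hinj⟩ (fun f => (M.submatrix f id).det ^ 2)
    |>.trans (Finset.sum_congr rfl fun f _ => ?_)]
  · exact Finset.sum_le_sum_of_subset_of_nonneg (Finset.subset_univ _) fun _ _ _ => sq_nonneg _
  · rfl

lemma det_form (d : ℝ) (hd : d ≠ 0) (n : ℕ) : ∃ C : ℝ, ∀ b : Fin n → ℕ,
    (B d n b).det = C * (∏ i, w (-d / Real.sqrt 2) (b i)) *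
      (Matrix.vandermonde fun i => (b i : ℝ)).det := by
  choose p hp hpe using fun j => E_form d hd j
  refine ⟨(Matrix.of fun (l j : Fin n) => (p j).coeff l).det, fun b => ?_⟩
  have : B d n b = Matrix.diagonal (fun i => w (-d / Real.sqrt 2) (b i)) *
      ((Matrix.vandermonde fun i => (b i : ℝ)) * (Matrix.of fun (l j : Fin n) => (p j).coeff l)) := by
    ext i j
    rw [Matrix.diagonal_mul, Matrix.mul_apply]
    simp only [B, Matrix.of_apply, hpe, Matrix.vandermonde_apply]
    rw [Polynomial.eval_eq_sum_range' (n := n) (lt_of_le_of_lt (hp j) j.2), Finset.sum_range]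
    congr 1
    exact Finset.sum_congr rfl fun l _ => mul_comm _ _
  rw [this, Matrix.det_mul, Matrix.det_mul, Matrix.det_diagonal]
  ring

lemma vand_cons (m : ℕ) (x : ℕ) (K : Fin m → ℕ) :
    (Matrix.vandermonde fun i => (((Fin.cons x K : Fin (m + 1) → ℕ) i : ℕ) : ℝ)).det =
      (∏ c, ((K c : ℝ) - x)) * (Matrix.vandermonde fun i => (K i : ℝ)).det := by
  rw [Matrix.det_vandermonde, Matrix.det_vandermonde, Fin.prod_univ_succ]
  congr 1
  · rw [Fin.prod_Ioi_zero]; simp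
  · refine Finset.prod_congr rfl fun i _ => ?_
    rw [Fin.prod_Ioi_succ]; simp


lemma prod_anti (f : ℕ → ℝ) (h0 : ∀ i, 0 ≤ f i) (ha : ∀ i j, 1 ≤ i → i ≤ j → f j ≤ f i)
    (T : Finset ℕ) (hT : ∀ i ∈ T, 1 ≤ i) : ∏ i ∈ T, f i ≤ ∏ i ∈ Finset.range T.card, f (i + 1) := by
  induction T using Finset.induction_on_max with
  | empty => simp
  | insert a s hs ih =>
    have hn : a ∉ s := fun h => lt_irrefl _ (hs a h)
    have hcard : s.card + 1 ≤ a := by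
      have : s ⊆ Finset.Ico 1 a := fun x hx =>
        Finset.mem_Ico.2 ⟨hT x (Finset.mem_insert_of_mem hx), hs x hx⟩
      have := Finset.card_le_card this
      have := hT a (Finset.mem_insert_self _ _)
      simp at *
      omega
    rw [Finset.prod_insert hn, Finset.card_insert_of_notMem hn, Finset.prod_range_succ, mul_comm]
    exact mul_le_mul (ih fun i hi => hT i (Finset.mem_insert_of_mem hi)) (ha _ _ (by omega) hcard)
      (h0 _) (Finset.prod_nonneg fun _ _ => h0 _)

lemma choose_low (n s : ℕ) : ((n.choose s : ℕ) : ℝ) ≤ 3 ^ s * (4 / 3) ^ n := by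
  induction n generalizing s with
  | zero =>
    cases s with
    | zero => simp
    | succ s => simp
  | succ n ih =>
    cases s with
    | zero => simp; exact one_le_pow₀ (by norm_num)
    | succ s =>
      rw [Nat.choose_succ_succ]
      have h1 := ih s
      have h2 := ih (s + 1)
      push_cast
      rw [pow_succ] at h2 ⊢
      rw [pow_succ (4 / 3 : ℝ)]
      linarith

lemma choose_high (n s : ℕ) : (((n + s).choose s : ℕ) : ℝ) ≤ 3 ^ s * (3 / 2) ^ (n + 1) := by
  induction n generalizing s with
  | zero =>
    simp
    have : (1 : ℝ) ≤ 3 ^ s := one_le_pow₀ (by norm_num)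
    linarith
  | succ n ihn =>
    induction s with
    | zero => simp; exact one_le_pow₀ (by norm_num)
    | succ s ih =>
      have h2 := ihn (s + 1)
      rw [show n + 1 + (s + 1) = (n + 1 + s) + 1 by ring, Nat.choose_succ_succ]
      rw [show n + (s + 1) = n + 1 + s by ring] at h2
      push_cast
      rw [pow_succ (3 : ℝ)] at h2 ⊢
      rw [pow_succ (3 / 2 : ℝ) (n + 1)] at ih ⊢
      linarith

lemma prod_low (n s : ℕ) (hn : 1 ≤ n) :
    ∏ i ∈ Finset.range s, (((n - (i + 1) : ℕ) : ℝ) / ((i + 1 : ℕ) : ℝ)) = (((n - 1).choose s : ℕ) : ℝ) := by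
  induction s with
  | zero => simp
  | succ s ih =>
    rw [Finset.prod_range_succ, ih]
    have := Nat.choose_succ_right_eq (n - 1) s
    rw [show n - (s + 1) = n - 1 - s by omega]
    have h : ((s + 1 : ℕ) : ℝ) ≠ 0 := by positivity
    field_simp
    rw [mul_comm (((s + 1 : ℕ) : ℝ))]
    exact_mod_cast this.symm

lemma prod_high (n s : ℕ) :
    ∏ i ∈ Finset.range s, (((n + (i + 1) : ℕ) : ℝ) / ((i + 1 : ℕ) : ℝ)) = (((n + s).choose s : ℕ) : ℝ) := by
  induction s with
  | zero => simp
  | succ s ih =>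
    rw [Finset.prod_range_succ, ih]
    have := Nat.add_one_mul_choose_eq (n + s) s
    have h : ((s + 1 : ℕ) : ℝ) ≠ 0 := by positivity
    field_simp
    rw [mul_comm, mul_comm (((s + 1 : ℕ) : ℝ))]
    exact_mod_cast this

lemma low_bound (k j : ℕ) (hkj : k < j) (T : Finset ℕ) (hT : ∀ a ∈ T, k < a ∧ a < j) :
    ∏ a ∈ T, (|(a : ℝ) - k| / |(a : ℝ) - j|) ≤ 3 ^ T.card * (4 / 3) ^ (j - k - 1) := by
  have hinj : Set.InjOn (fun a => j - a) (T : Set ℕ) := by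
    intro a ha b hb h
    have := hT a ha
    have := hT b hb
    simp only at h
    omega
  have h1 : ∏ a ∈ T, (|(a : ℝ) - k| / |(a : ℝ) - j|) =
      ∏ i ∈ T.image (fun a => j - a), (((j - k - i : ℕ) : ℝ) / (i : ℝ)) := by
    rw [Finset.prod_image hinj]
    refine Finset.prod_congr rfl fun a ha => ?_
    obtain ⟨h1, h2⟩ := hT a ha
    rw [show j - k - (j - a) = a - k by omega, Nat.cast_sub h1.le, Nat.cast_sub h2.le]
    have : (k : ℝ) < a := by exact_mod_cast h1
    have : (a : ℝ) < j := by exact_mod_cast h2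
    rw [abs_of_pos (by linarith), abs_of_neg (by linarith)]
    congr 1; ring
  rw [h1]
  refine (prod_anti (fun i => ((j - k - i : ℕ) : ℝ) / (i : ℝ)) (fun i => by positivity) ?_ _ ?_).trans ?_
  · intro a b ha hab
    have : (0 : ℝ) < a := by exact_mod_cast ha
    gcongr
  · intro i hi
    obtain ⟨a, ha, rfl⟩ := Finset.mem_image.1 hi
    have := hT a ha
    omega
  · rw [Finset.card_image_of_injOn hinj, prod_low _ _ (by omega)]
    exact choose_low _ _

lemma high_bound (k j : ℕ) (hkj : k < j) (T : Finset ℕ) (hT : ∀ a ∈ T, j < a) :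
    ∏ a ∈ T, (|(a : ℝ) - k| / |(a : ℝ) - j|) ≤ 3 ^ T.card * (3 / 2) ^ (j - k + 1) := by
  have hinj : Set.InjOn (fun a => a - j) (T : Set ℕ) := by
    intro a ha b hb h
    have := hT a ha
    have := hT b hb
    simp only at h
    omega
  have h1 : ∏ a ∈ T, (|(a : ℝ) - k| / |(a : ℝ) - j|) =
      ∏ i ∈ T.image (fun a => a - j), (((j - k + i : ℕ) : ℝ) / (i : ℝ)) := by
    rw [Finset.prod_image hinj]
    refine Finset.prod_congr rfl fun a ha => ?_
    have h2 := hT a ha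
    rw [show j - k + (a - j) = a - k by omega, Nat.cast_sub (by omega), Nat.cast_sub h2.le]
    have : (k : ℝ) < j := by exact_mod_cast hkj
    have : (j : ℝ) < a := by exact_mod_cast h2
    rw [abs_of_pos (by linarith), abs_of_pos (by linarith)]
  rw [h1]
  refine (prod_anti (fun i => ((j - k + i : ℕ) : ℝ) / (i : ℝ)) (fun i => by positivity) ?_ _ ?_).trans ?_
  · intro a b ha hab
    have h0 : (0 : ℝ) < a := by exact_mod_cast ha
    have h1 : (a : ℝ) ≤ b := by exact_mod_cast hab
    have h2 : (0 : ℝ) ≤ ((j - k : ℕ) : ℝ) := by positivity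
    rw [div_le_div_iff₀ (by linarith) h0]
    push_cast [-Nat.cast_sub]
    nlinarith
  · intro i hi
    obtain ⟨a, ha, rfl⟩ := Finset.mem_image.1 hi
    have := hT a ha
    omega
  · rw [Finset.card_image_of_injOn hinj, prod_high]
    exact choose_high _ _

lemma K_bound (m k j : ℕ) (K : Fin m → ℕ) (hK : Function.Injective K) (hk : k ≤ m) (hj : m + 1 ≤ j)
    (h : ∀ c, m + 1 ≤ K c ∧ K c ≠ j) :
    ∏ c, |(K c : ℝ) - k| ≤ 4 ^ (m + 1) * 2 ^ j * ∏ c, |(K c : ℝ) - j| := by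
  have hpos : 0 < ∏ c, |(K c : ℝ) - j| := Finset.prod_pos fun c _ => by
    rw [abs_pos, sub_ne_zero]
    exact_mod_cast (h c).2
  rw [← div_le_iff₀ hpos, ← Finset.prod_div_distrib]
  have e : ∏ c, (|(K c : ℝ) - k| / |(K c : ℝ) - j|) =
      ∏ a ∈ Finset.univ.image K, (|(a : ℝ) - k| / |(a : ℝ) - j|) := by
    rw [Finset.prod_image hK.injOn]
  rw [e, ← Finset.prod_filter_mul_prod_filter_not _ (fun a => a < j)]
  set T := Finset.univ.image K
  have hc : (T.filter (fun a => a < j)).card + (T.filter (fun a => ¬ a < j)).card = m := by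
    rw [Finset.card_filter_add_card_filter_not, Finset.card_image_of_injective _ hK]
    simp
  have hl := low_bound k j (by omega) (T.filter (fun a => a < j)) (by
    intro a ha
    obtain ⟨ha, ha'⟩ := Finset.mem_filter.1 ha
    obtain ⟨c, -, rfl⟩ := Finset.mem_image.1 ha
    have := h c
    omega)
  have hh := high_bound k j (by omega) (T.filter (fun a => ¬ a < j)) (by
    intro a ha
    obtain ⟨ha, ha'⟩ := Finset.mem_filter.1 ha
    obtain ⟨c, -, rfl⟩ := Finset.mem_image.1 ha
    have := h c
    omega)
  refine (mul_le_mul hl hh (Finset.prod_nonneg fun _ _ => by positivity) (by positivity)).trans ?_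
  obtain ⟨n, hn⟩ : ∃ n, j - k = n + 1 := ⟨j - k - 1, by omega⟩
  have e2 : (4 / 3 : ℝ) ^ n * (3 / 2) ^ n = 2 ^ n := by rw [← mul_pow]; norm_num
  rw [hn, Nat.add_sub_cancel]
  set s := (T.filter (fun a => a < j)).card
  set t := (T.filter (fun a => ¬ a < j)).card
  have e3 : (3 : ℝ) ^ s * 3 ^ t = 3 ^ m := by rw [← pow_add, hc]
  calc (3 : ℝ) ^ s * (4 / 3) ^ n * (3 ^ t * (3 / 2) ^ (n + 1 + 1))
      = (3 ^ s * 3 ^ t) * ((4 / 3) ^ n * (3 / 2) ^ n) * (9 / 4) := by ring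
    _ = 3 ^ m * 2 ^ n * (9 / 4) := by rw [e2, e3]
    _ ≤ 4 ^ m * 2 ^ j * 4 := by
      have : n ≤ j := by omega
      gcongr <;> norm_num
    _ = _ := by ring

lemma term_bound (d : ℝ) (hd : 0 < d) (m k j : ℕ) (K : Fin m → ℕ) (hK : Function.Injective K)
    (hk : k ≤ m) (hj : m + 1 ≤ j) (h : ∀ c, m + 1 ≤ K c ∧ K c ≠ j) :
    (B d (m + 1) (Fin.cons k K : Fin (m + 1) → ℕ)).det ^ 2 ≤
      (Real.exp (d ^ 2 / 4) * 4 ^ (m + 1) * (2 * Real.sqrt 2 / d) ^ j * Real.sqrt j.factorial) ^ 2 *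
      (B d (m + 1) (Fin.cons j K : Fin (m + 1) → ℕ)).det ^ 2 := by
  obtain ⟨C, hC⟩ := det_form d hd.ne' (m + 1)
  have s2 : Real.sqrt (2 : ℝ) ^ 2 = 2 := Real.sq_sqrt (by norm_num)
  have hw : ∀ a, w (-d / Real.sqrt 2) a ^ 2 = (d ^ 2 / 2) ^ a / a.factorial := by
    intro a
    unfold w
    rw [div_pow, Real.sq_sqrt (by positivity), ← pow_mul, mul_comm a 2, pow_mul, div_pow, s2, neg_sq]
  rw [hC, hC, vand_cons, vand_cons, Fin.prod_univ_succ, Fin.prod_univ_succ]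
  simp only [Fin.cons_zero, Fin.cons_succ]
  set W := ∏ i, w (-d / Real.sqrt 2) (K i)
  set V := (Matrix.vandermonde fun i => (K i : ℝ)).det
  have hb := K_bound m k j K hK hk hj h
  rw [← Finset.abs_prod, ← Finset.abs_prod] at hb
  set P := ∏ c, ((K c : ℝ) - k)
  set Q := ∏ c, ((K c : ℝ) - j)
  have hb2 : P ^ 2 ≤ (4 ^ (m + 1) * 2 ^ j) ^ 2 * Q ^ 2 := by
    rw [← sq_abs P, ← sq_abs Q, ← mul_pow]
    exact pow_le_pow_left₀ (abs_nonneg _) hb 2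
  have hwk : w (-d / Real.sqrt 2) k ^ 2 ≤ Real.exp (d ^ 2 / 4) ^ 2 := by
    rw [hw, ← Real.exp_nat_mul]
    have := Real.pow_div_factorial_le_exp (d ^ 2 / 2) (by positivity) k
    refine this.trans (le_of_eq ?_)
    congr 1; push_cast; ring
  have hwj : ((2 * Real.sqrt 2 / d) ^ j * Real.sqrt j.factorial) ^ 2 * w (-d / Real.sqrt 2) j ^ 2
      = (2 ^ j) ^ 2 := by
    rw [hw, mul_pow, Real.sq_sqrt (by positivity), ← pow_mul, mul_comm j 2, pow_mul, div_pow, mul_pow, s2]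
    have : ((2 : ℝ) ^ 2 * 2 / d ^ 2) ^ j * (d ^ 2 / 2) ^ j = (2 ^ j) ^ 2 := by
      rw [← mul_pow, ← pow_mul, mul_comm j 2, pow_mul]
      congr 1
      field_simp
    have hf : (j.factorial : ℝ) ≠ 0 := by positivity
    rw [← this]
    field_simp
  calc (C * (w (-d / Real.sqrt 2) k * W) * (P * V)) ^ 2
      = (C * W * V) ^ 2 * (w (-d / Real.sqrt 2) k ^ 2 * P ^ 2) := by ring
    _ ≤ (C * W * V) ^ 2 * (Real.exp (d ^ 2 / 4) ^ 2 * ((4 ^ (m + 1) * 2 ^ j) ^ 2 * Q ^ 2)) := by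
      gcongr
    _ = (C * W * V) ^ 2 * (Real.exp (d ^ 2 / 4) ^ 2 * ((4 ^ (m + 1)) ^ 2 * (2 ^ j) ^ 2 * Q ^ 2)) := by ring
    _ = _ := by rw [← hwj]; ring

lemma sum_bound (m : ℕ) (r σ : ℝ) (hσ : 0 < σ) (j : ℕ) (hj : m + 1 ≤ j)
    (F : Finset {a : Fin m → ℕ // StrictMono a ∧ ∀ c, m + 1 ≤ a c ∧ a c ≠ j}) :
    ∑ K ∈ F, (B (r / σ) (m + 1) (Fin.cons j K.val : Fin (m + 1) → ℕ)).det ^ 2 ≤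
      (matA (m + 1) r σ).det := by
  classical
  set d := r / σ with hd
  let S : Finset ℕ := insert j (F.biUnion fun K => Finset.univ.image K.val)
  have hS : ∀ a ∈ S, m + 1 ≤ a := by
    intro a ha
    rcases Finset.mem_insert.1 ha with rfl | ha
    · exact hj
    · obtain ⟨K, -, hK⟩ := Finset.mem_biUnion.1 ha
      obtain ⟨c, -, rfl⟩ := Finset.mem_image.1 hK
      exact (K.2.2 c).1
  have hmem : ∀ K ∈ F, ∀ i, (Fin.cons j K.val : Fin (m + 1) → ℕ) i ∈ S := by
    intro K hK i
    refine Fin.cases ?_ (fun c => ?_) i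
    · simp [S]
    · rw [Fin.cons_succ]
      exact Finset.mem_insert_of_mem (Finset.mem_biUnion.2 ⟨K, hK, Finset.mem_image_of_mem _ (Finset.mem_univ _)⟩)
  have hinjK : ∀ K : {a : Fin m → ℕ // StrictMono a ∧ ∀ c, m + 1 ≤ a c ∧ a c ≠ j},
      Function.Injective (Fin.cons j K.val : Fin (m + 1) → ℕ) := by
    intro K
    rw [Fin.cons_injective_iff]
    refine ⟨?_, K.2.1.injective⟩
    rintro ⟨c, hc⟩
    exact (K.2.2 c).2 hc
  let Φ : F × Equiv.Perm (Fin (m + 1)) → (Fin (m + 1) → S) := fun p i =>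
    ⟨(Fin.cons j p.1.1.val : Fin (m + 1) → ℕ) (p.2 i), hmem _ p.1.2 _⟩
  have hΦ : Function.Injective Φ := by
    rintro ⟨K, π⟩ ⟨L, τ⟩ h
    have h1 : ∀ i, (Fin.cons j K.1.val : Fin (m + 1) → ℕ) (π i) =
        (Fin.cons j L.1.val : Fin (m + 1) → ℕ) (τ i) := fun i => congrArg Subtype.val (congrFun h i)
    have hr : Set.range (Fin.cons j K.1.val : Fin (m + 1) → ℕ) =
        Set.range (Fin.cons j L.1.val : Fin (m + 1) → ℕ) := by
      rw [← π.surjective.range_comp (Fin.cons j K.1.val : Fin (m + 1) → ℕ),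
        ← τ.surjective.range_comp (Fin.cons j L.1.val : Fin (m + 1) → ℕ)]
      congr 1
      funext i
      exact h1 i
    have hrr : ∀ K : {a : Fin m → ℕ // StrictMono a ∧ ∀ c, m + 1 ≤ a c ∧ a c ≠ j},
        Set.range K.val = Set.range (Fin.cons j K.val : Fin (m + 1) → ℕ) \ {j} := by
      intro K
      rw [Fin.range_cons]
      ext x
      simp only [Set.mem_sdiff, Set.mem_insert_iff, Set.mem_singleton_iff]
      constructor
      · rintro ⟨c, rfl⟩
        exact ⟨Or.inr ⟨c, rfl⟩, (K.2.2 c).2⟩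
      · rintro ⟨h | h, h'⟩
        · exact absurd h h'
        · exact h
    have hKL : K = L := by
      apply Subtype.ext
      apply Subtype.ext
      have := hrr K.1
      rw [hr, ← hrr L.1] at this
      exact (StrictMono.range_inj K.1.2.1 L.1.2.1).1 this
    subst hKL
    have : π = τ := Equiv.ext fun i => hinjK K.1 (h1 i)
    rw [this]
  have hcb := cb (m + 1) r σ hσ S hS
  have hle : ∑ p : F × Equiv.Perm (Fin (m + 1)), (B d (m + 1) (fun i => (Φ p i : ℕ))).det ^ 2 ≤
      ∑ f : Fin (m + 1) → S, (B d (m + 1) (fun i => (f i : ℕ))).det ^ 2 := by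
    have := Finset.sum_map Finset.univ ⟨Φ, hΦ⟩ (fun f => (B d (m + 1) (fun i => (f i : ℕ))).det ^ 2)
    refine (le_of_eq this.symm).trans ?_
    exact Finset.sum_le_sum_of_subset_of_nonneg (Finset.subset_univ _) fun _ _ _ => sq_nonneg _
  have heq : ∑ p : F × Equiv.Perm (Fin (m + 1)), (B d (m + 1) (fun i => (Φ p i : ℕ))).det ^ 2 =
      ((m + 1).factorial : ℝ) *
      ∑ K ∈ F, (B d (m + 1) (Fin.cons j K.val : Fin (m + 1) → ℕ)).det ^ 2 := by
    rw [Fintype.sum_prod_type, Finset.mul_sum, ← Finset.sum_coe_sort F]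
    refine Finset.sum_congr rfl fun K _ => ?_
    have : ∀ π : Equiv.Perm (Fin (m + 1)), (B d (m + 1) (fun i => (Φ (K, π) i : ℕ))).det ^ 2 =
        (B d (m + 1) (Fin.cons j K.1.val : Fin (m + 1) → ℕ)).det ^ 2 := by
      intro π
      have := Matrix.det_permute π (B d (m + 1) (Fin.cons j K.1.val : Fin (m + 1) → ℕ))
      have e : (B d (m + 1) (fun i => (Φ (K, π) i : ℕ))) =
        (B d (m + 1) (Fin.cons j K.1.val : Fin (m + 1) → ℕ)).submatrix π id := rfl
      rw [e, this, mul_pow]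
      have : (((Equiv.Perm.sign π : ℤ) : ℝ)) ^ 2 = 1 := by
        rcases Int.units_eq_one_or (Equiv.Perm.sign π) with h | h <;> simp [h]
      rw [this, one_mul]
    simp_rw [this]
    simp [Fintype.card_perm]
  rw [heq] at hle
  exact le_of_mul_le_mul_left (hle.trans hcb) (by positivity)

end Sub

/-- Lemma 32. For `ℓ = m + 1 ≥ 1`, `k ∈ [ℓ]`, `j ≥ ℓ`, the sum over
`K ∈ 𝒦_j` (size `ℓ−1` subsets of `{ℓ, ℓ+1, …}` avoiding `j`, encoded as strictly
monotone tuples) of `det(U_{K∪{k}})²` is controlled by `det(A)`. -/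
theorem stmt10 (σ r : ℝ) (hσ : 0 < σ) (hr : 0 < r) (m : ℕ) (k : Fin (m + 1)) (j : ℕ)
    (hj : m + 1 ≤ j) :
    (∑' K : {a : Fin m → ℕ // StrictMono a ∧ ∀ c, m + 1 ≤ a c ∧ a c ≠ j},
        ((UKmat (m + 1) σ r (Fin.cons k.val K.val)).det) ^ 2) ≤
      (Real.exp (r ^ 2 / (4 * σ ^ 2)) * 4 ^ (m + 1) * (2 * Real.sqrt 2 * σ / r) ^ j *
          Real.sqrt (Nat.factorial j)) ^ 2 * (matA (m + 1) r σ).det := by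
  have hd : 0 < r / σ := div_pos hr hσ
  have hU : ∀ b : Fin (m + 1) → ℕ, UKmat (m + 1) σ r b = Sub.B (r / σ) (m + 1) b := by
    intro b
    ext i l
    simp [UKmat, Sub.B, Sub.ip_psi _ _ _ _ _ hσ, Sub.E]
  have e1 : r ^ 2 / (4 * σ ^ 2) = (r / σ) ^ 2 / 4 := by
    field_simp
  have e2 : 2 * Real.sqrt 2 * σ / r = 2 * Real.sqrt 2 / (r / σ) := by
    field_simp
  simp_rw [hU]
  rw [e1, e2]
  refine Real.tsum_le_of_sum_le (fun _ => sq_nonneg _) fun F => ?_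
  refine (Finset.sum_le_sum fun K _ => Sub.term_bound (r / σ) hd m k.val j K.val
    K.2.1.injective (by omega) hj K.2.2).trans ?_
  rw [← Finset.mul_sum]
  exact mul_le_mul_of_nonneg_left (Sub.sum_bound m r σ hσ j hj F) (sq_nonneg _)
end
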